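/- arXiv:1311.4723 — 3 statements merged into one kernel-verified Lean document; each statement's English description precedes it below -/
import Mathlib

section
/- (Direct scheme of Theorem 1, one stage.) Let c : 𝒳 → {0,1}* be a binary prefix code with length function l(·) and maximal length l_max = max_x l(x). Let X ~ P on 𝒳, let K be uniform on {0,1}^{l_max} independent of X, and let V be a uniform random string independent of (X, K). Define Z ∈ {0,1}^{l_max} by setting its first l(X) bits to c(X) XORed with the first l(X) bits of K, and its remaining l_max − l(X) bits to bits of V. Then: (a) Z is uniformly distributed on {0,1}^{l_max} and independent of X; and (b) X is a deterministic function of (Z, K): XORing Z with K bit-by-bit, the first (and unique) prefix of the result that is a codeword of c equals c(X), so X is recovered without error. -/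
open scoped BigOperators Classical

noncomputable section

/-- Probability of the event `E` on a finite probability space with mass function `p`. -/
def pr {Ω : Type*} [Fintype Ω] (p : Ω → ℝ) (E : Ω → Prop) : ℝ :=
  ∑ ω : Ω, if E ω then p ω else 0

/-- The padded one-time-pad encoder of the direct part of Theorem 1: the first `l(x)` bits
of the output block are the codeword `c x` XORed with the key `k`, and the remaining
`L − l(x)` bits are the private random padding bits `v`. -/
def encodeBlock {𝒳 : Type*} (c : 𝒳 → List Bool) (L : ℕ)
    (x : 𝒳) (k v : Fin L → Bool) : Fin L → Bool :=
  fun i => if (i : ℕ) < (c x).length then Bool.xor ((c x).getD i false) (k i) else v i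

/-- Swap the used key bits with the unused padding bits. -/
def encEquiv {𝒳 : Type*} (c : 𝒳 → List Bool) (L : ℕ) (x : 𝒳) :
    ((Fin L → Bool) × (Fin L → Bool)) ≃ ((Fin L → Bool) × (Fin L → Bool)) where
  toFun q := (encodeBlock c L x q.1 q.2,
    fun i => if (i : ℕ) < (c x).length then q.2 i else q.1 i)
  invFun q := (fun i => if (i : ℕ) < (c x).length then
      Bool.xor ((c x).getD i false) (q.1 i) else q.2 i,
    fun i => if (i : ℕ) < (c x).length then q.2 i else q.1 i)
  left_inv q := by
    ext i <;> by_cases h : (i : ℕ) < (c x).length <;> simp [encodeBlock, h]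
  right_inv q := by
    ext i <;> by_cases h : (i : ℕ) < (c x).length <;> simp [encodeBlock, h]

theorem sum_enc {𝒳 : Type*} (c : 𝒳 → List Bool) (L : ℕ) (x : 𝒳) (z : Fin L → Bool) (a : ℝ) :
    (∑ q : (Fin L → Bool) × (Fin L → Bool),
      if encodeBlock c L x q.1 q.2 = z then a else 0) = 2 ^ L * a := by
  have h := Equiv.sum_comp (encEquiv c L x)
    (fun q : (Fin L → Bool) × (Fin L → Bool) => if q.1 = z then a else 0)
  have h2 : (∑ q : (Fin L → Bool) × (Fin L → Bool), if q.1 = z then a else 0) = 2 ^ L * a := by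
    rw [Fintype.sum_prod_type, Finset.sum_comm]
    simp
  rw [← h2, ← h]
  rfl

theorem codeword_prefix {𝒳 : Type*} (c : 𝒳 → List Bool) (L : ℕ) (x : 𝒳)
    (hx : (c x).length ≤ L) (k v : Fin L → Bool) :
    c x <+: List.ofFn (fun i : Fin L => Bool.xor (encodeBlock c L x k v i) (k i)) := by
  rw [List.prefix_iff_eq_take]
  apply List.ext_getElem
  · simp [hx]
  · intro i h1 h2
    simp [encodeBlock, h1]

/-- **Direct scheme of Theorem 1 (one stage).** Let `c : 𝒳 → {0,1}*` be a binary prefix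
code with maximal codeword length `L`, let `X ~ P` on the finite alphabet `𝒳`, let `K` be
uniform on `{0,1}^L` independent of `X`, and let `V` be a uniform random padding string
independent of `(X, K)` (all realized canonically on `Ω = 𝒳 × {0,1}^L × {0,1}^L`). Let
`Z ∈ {0,1}^L` consist of `c(X)` XORed with the first `l(X)` bits of `K`, padded by bits
of `V`. Then (a) `Z` is uniform on `{0,1}^L` and independent of `X`, and (b) `X` is a
deterministic function of `(Z, K)`: the first (and unique) prefix of the bitwise XOR of
`Z` and `K` that is a codeword of `c` is `c(X)`, so `X` is recovered without error. -/
theorem one_time_pad_padded_block_secure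
    {𝒳 : Type*} [Fintype 𝒳] [Nonempty 𝒳]
    (P : 𝒳 → ℝ) (hP : ∀ x, 0 ≤ P x) (hP1 : ∑ x : 𝒳, P x = 1)
    (c : 𝒳 → List Bool) (hinj : Function.Injective c)
    (hprefix : ∀ x y : 𝒳, c x <+: c y → c x = c y)
    (L : ℕ) (hL : L = Finset.univ.sup fun x => (c x).length)
    (p : (𝒳 × (Fin L → Bool) × (Fin L → Bool)) → ℝ)
    (hp : p = fun ω => P ω.1 * (1 / 2) ^ L * (1 / 2) ^ L) :
    (∀ z : Fin L → Bool,
        pr p (fun ω => encodeBlock c L ω.1 ω.2.1 ω.2.2 = z) = (1 / 2) ^ L) ∧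
    (∀ (z : Fin L → Bool) (x : 𝒳),
        pr p (fun ω => encodeBlock c L ω.1 ω.2.1 ω.2.2 = z ∧ ω.1 = x)
          = pr p (fun ω => encodeBlock c L ω.1 ω.2.1 ω.2.2 = z) *
            pr p (fun ω => ω.1 = x)) ∧
    (∀ (ω : 𝒳 × (Fin L → Bool) × (Fin L → Bool)) (w : List Bool),
        ((∃ x, c x = w) ∧
            w <+: List.ofFn (fun i : Fin L =>
              Bool.xor (encodeBlock c L ω.1 ω.2.1 ω.2.2 i) (ω.2.1 i)))
          ↔ w = c ω.1) ∧
    (∃ dec : (Fin L → Bool) → (Fin L → Bool) → 𝒳,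
        ∀ ω : 𝒳 × (Fin L → Bool) × (Fin L → Bool),
          dec (encodeBlock c L ω.1 ω.2.1 ω.2.2) ω.2.1 = ω.1) := by
  have hlen : ∀ x, (c x).length ≤ L := fun x => by
    rw [hL]; exact Finset.le_sup (f := fun x => (c x).length) (Finset.mem_univ x)
  have h22 : (2 : ℝ) ^ L * (1 / 2) ^ L = 1 := by
    rw [← mul_pow]; norm_num
  have hjoint : ∀ (z : Fin L → Bool) (x : 𝒳),
      pr p (fun ω => encodeBlock c L ω.1 ω.2.1 ω.2.2 = z ∧ ω.1 = x) = P x * (1 / 2) ^ L := by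
    intro z x
    unfold pr
    rw [Fintype.sum_prod_type, Finset.sum_eq_single x]
    · simp only [and_true, hp]
      rw [sum_enc]
      linear_combination (P x * (1 / 2) ^ L) * h22
    · intro y _ hy
      simp [hy]
    · simp
  have hZ : ∀ z : Fin L → Bool,
      pr p (fun ω => encodeBlock c L ω.1 ω.2.1 ω.2.2 = z) = (1 / 2) ^ L := by
    intro z
    unfold pr
    rw [Fintype.sum_prod_type]
    simp only [hp]
    simp only [sum_enc]
    rw [← Finset.mul_sum, ← Finset.sum_mul, ← Finset.sum_mul, hP1]
    linear_combination ((1 / 2) ^ L) * h22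
  have hX : ∀ x : 𝒳, pr p (fun ω => ω.1 = x) = P x := by
    intro x
    unfold pr
    rw [Fintype.sum_prod_type, Finset.sum_eq_single x]
    · simp only [hp, if_true, Finset.sum_const, Finset.card_univ, Fintype.card_prod,
        Fintype.card_fun, Fintype.card_bool, Fintype.card_fin, nsmul_eq_mul]
      push_cast
      linear_combination (P x * (2 ^ L * (1 / 2) ^ L + 1)) * h22
    · intro y _ hy
      simp [hy]
    · simp
  have hdec : ∀ (ω : 𝒳 × (Fin L → Bool) × (Fin L → Bool)) (w : List Bool),
        ((∃ x, c x = w) ∧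
            w <+: List.ofFn (fun i : Fin L =>
              Bool.xor (encodeBlock c L ω.1 ω.2.1 ω.2.2 i) (ω.2.1 i)))
          ↔ w = c ω.1 := by
    rintro ⟨x, k, v⟩ w
    have hc := codeword_prefix c L x (hlen x) k v
    constructor
    · rintro ⟨⟨y, rfl⟩, hy⟩
      rcases List.prefix_or_prefix_of_prefix hy hc with h | h
      · exact hprefix _ _ h
      · exact (hprefix _ _ h).symm
    · rintro rfl
      exact ⟨⟨x, rfl⟩, hc⟩
  refine ⟨hZ, ?_, hdec, ?_⟩
  · intro z x
    rw [hjoint, hZ, hX, mul_comm]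
  · refine ⟨fun z k => Classical.epsilon fun x =>
      c x <+: List.ofFn (fun i : Fin L => Bool.xor (z i) (k i)), fun ω => ?_⟩
    have hs := Classical.epsilon_spec (p := fun x =>
      c x <+: List.ofFn (fun i : Fin L =>
        Bool.xor (encodeBlock c L ω.1 ω.2.1 ω.2.2 i) (ω.2.1 i)))
      ⟨ω.1, codeword_prefix c L ω.1 (hlen _) _ _⟩
    exact hinj ((hdec ω _).1 ⟨⟨_, rfl⟩, hs⟩)
end
end

section
/- The Huffman length is continuous in variational distance: for any two probability distributions P and Q on a finite alphabet 𝒳, |L(P) − L(Q)| ≤ (|𝒳| − 1) · ‖P − Q‖₁, where ‖P − Q‖₁ = Σ_x |P(x) − Q(x)|. In particular, if ‖P − Q‖₁ ≤ ε then L(P) ≥ L(Q) − ε(|𝒳| − 1). -/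
open scoped BigOperators

noncomputable section

/-- The (optimal expected) Huffman length of a probability vector `q` on a finite alphabet
`𝒳`: the minimum of `∑ x, q x * l x` over all length functions `l : 𝒳 → ℤ⁺` (modeled as
`l : 𝒳 → ℕ` with `1 ≤ l x`) satisfying Kraft's inequality; the minimum is attained by a
length function with `max_x l x ≤ |𝒳| - 1`. -/
def huffLen {𝒳 : Type*} [Fintype 𝒳] (q : 𝒳 → ℝ) : ℝ :=
  sInf { r : ℝ | ∃ l : 𝒳 → ℕ, (∀ x, 1 ≤ l x) ∧
    (∑ x : 𝒳, (2 : ℝ) ^ (-(l x : ℝ))) ≤ 1 ∧ r = ∑ x : 𝒳, q x * (l x : ℝ) }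

/-- Binary weight. -/
def bw (n : ℕ) : ℕ := (Nat.digits 2 n).sum

lemma bw_step (y b : ℕ) (hb : b < 2) : bw (2 * y + b) = bw y + b := by
  unfold bw
  rcases Nat.eq_zero_or_pos (2 * y + b) with h | h
  · have hy : y = 0 := by omega
    have hb0 : b = 0 := by omega
    subst hy; subst hb0; simp
  · rw [Nat.digits_def' (by norm_num) h]
    have h1 : (2 * y + b) % 2 = b := by omega
    have h2 : (2 * y + b) / 2 = y := by omega
    rw [h1, h2]; simp [add_comm]

lemma bw_succ (x : ℕ) : bw (x + 1) ≤ bw x + 1 := by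
  induction x using Nat.strong_induction_on with
  | _ x ih =>
    rcases Nat.even_or_odd' x with ⟨y, rfl | rfl⟩
    · have h1 := bw_step y 1 (by norm_num)
      have h2 := bw_step y 0 (by norm_num)
      simp only [add_zero] at h2
      omega
    · have h1 := bw_step y 1 (by norm_num)
      have h2 := bw_step (y + 1) 0 (by norm_num)
      have h3 := ih y (by omega)
      have h4 : 2 * y + 1 + 1 = 2 * (y + 1) + 0 := by ring
      rw [h4, h2, h1]; omega

lemma bw_add_pow (a : ℕ) : ∀ x, bw (x + 2 ^ a) ≤ bw x + 1 := by
  induction a with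
  | zero => intro x; simpa using bw_succ x
  | succ a ih =>
    intro x
    have hx : 2 * (x / 2) + x % 2 = x := by omega
    have hb : x % 2 < 2 := by omega
    have h1 := bw_step (x / 2) (x % 2) hb
    have h2 := bw_step (x / 2 + 2 ^ a) (x % 2) hb
    have h3 := ih (x / 2)
    have h4 : x + 2 ^ (a + 1) = 2 * (x / 2 + 2 ^ a) + x % 2 := by rw [pow_succ]; omega
    rw [h4, h2]
    rw [hx] at h1
    omega

lemma bw_sum {ι : Type*} (s : Finset ι) (a : ι → ℕ) : bw (∑ i ∈ s, 2 ^ a i) ≤ s.card := by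
  classical
  induction s using Finset.induction_on with
  | empty => simp [bw]
  | insert i s hi ih =>
    rw [Finset.sum_insert hi, Finset.card_insert_of_notMem hi, add_comm]
    exact (bw_add_pow _ _).trans (by omega)

lemma bw_mersenne (M : ℕ) : bw (2 ^ M - 1) = M := by
  induction M with
  | zero => simp [bw]
  | succ M ih =>
    have h := bw_step (2 ^ M - 1) 1 (by norm_num)
    have hp : 0 < 2 ^ M := by positivity
    have h4 : 2 ^ (M + 1) - 1 = 2 * (2 ^ M - 1) + 1 := by rw [pow_succ]; omega
    rw [h4, h, ih]

lemma kraft_iff {𝒳 : Type*} [Fintype 𝒳] (l : 𝒳 → ℕ) (M : ℕ) (h : ∀ x, l x ≤ M) :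
    (∑ x : 𝒳, (2 : ℝ) ^ (-(l x : ℝ))) ≤ 1 ↔ ∑ x : 𝒳, 2 ^ (M - l x) ≤ 2 ^ M := by
  have e : ((∑ x : 𝒳, 2 ^ (M - l x) : ℕ) : ℝ) = 2 ^ M * ∑ x : 𝒳, (2 : ℝ) ^ (-(l x : ℝ)) := by
    push_cast
    rw [Finset.mul_sum]
    refine Finset.sum_congr rfl fun x _ => ?_
    rw [Real.rpow_neg (by norm_num), Real.rpow_natCast, pow_sub₀ _ (by norm_num) (h x)]
  have hp : (0 : ℝ) < 2 ^ M := by positivity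
  rw [← Nat.cast_le (α := ℝ), e]
  push_cast
  constructor
  · intro hh; nlinarith
  · intro hh; exact le_of_mul_le_mul_left (by linarith) hp

lemma exists_short {𝒳 : Type*} [Fintype 𝒳] (hn : 2 ≤ Fintype.card 𝒳) (N : ℕ) :
    ∀ l : 𝒳 → ℕ, ∑ x, l x = N → (∀ x, 1 ≤ l x) →
      (∑ x : 𝒳, (2 : ℝ) ^ (-(l x : ℝ))) ≤ 1 →
      ∃ l' : 𝒳 → ℕ, (∀ x, 1 ≤ l' x) ∧ (∑ x : 𝒳, (2 : ℝ) ^ (-(l' x : ℝ))) ≤ 1 ∧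
        (∀ x, l' x ≤ l x) ∧ ∀ x, l' x ≤ Fintype.card 𝒳 - 1 := by
  classical
  induction N using Nat.strong_induction_on with
  | _ N ih =>
    intro l hN h1 hK
    by_cases hs : ∀ x, l x ≤ Fintype.card 𝒳 - 1
    · exact ⟨l, h1, hK, fun _ => le_rfl, hs⟩
    push Not at hs
    obtain ⟨z, hz⟩ := hs
    have : Nonempty 𝒳 := ⟨z⟩
    obtain ⟨m, hm⟩ := Finite.exists_max l
    have hmz := hm z
    set l2 := Function.update l m (l m - 1) with hl2
    have hle : ∀ x, l2 x ≤ l x := by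
      intro x
      by_cases hx : x = m
      · subst hx; simp [hl2]
      · simp [hl2, hx]
    by_cases hK2 : (∑ x : 𝒳, (2 : ℝ) ^ (-(l2 x : ℝ))) ≤ 1
    · have hlt : ∑ x, l2 x < N := by
        rw [← hN]
        refine Finset.sum_lt_sum (fun x _ => hle x) ⟨m, Finset.mem_univ _, ?_⟩
        have := h1 m
        simp only [hl2, Function.update_self]; omega
      obtain ⟨l', a, b, c, d⟩ := ih _ hlt l2 rfl (by
        intro x
        by_cases hx : x = m
        · subst hx; simp only [hl2, Function.update_self]; omega
        · simpa [hl2, hx] using h1 x) hK2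
      exact ⟨l', a, b, fun x => (c x).trans (hle x), d⟩
    · exfalso
      rw [kraft_iff l (l m) hm] at hK
      rw [kraft_iff l2 (l m) (fun x => (hle x).trans (hm x))] at hK2
      rw [← Finset.add_sum_erase _ _ (Finset.mem_univ m)] at hK hK2
      have e : ∑ x ∈ Finset.univ.erase m, 2 ^ (l m - l2 x)
          = ∑ x ∈ Finset.univ.erase m, 2 ^ (l m - l x) := by
        refine Finset.sum_congr rfl fun x hx => ?_
        simp [hl2, Finset.ne_of_mem_erase hx]
      have e1 : l m - l2 m = 1 := by
        have := h1 m
        simp only [hl2, Function.update_self]; omega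
      rw [e, e1] at hK2
      simp only [Nat.sub_self, pow_zero, pow_one] at hK hK2
      have hE : ∑ x ∈ Finset.univ.erase m, 2 ^ (l m - l x) = 2 ^ (l m) - 1 := by omega
      have hb := bw_sum (Finset.univ.erase m) (fun x => l m - l x)
      rw [hE, bw_mersenne, Finset.card_erase_of_mem (Finset.mem_univ m), Finset.card_univ] at hb
      omega

lemma huff_one_side {𝒳 : Type*} [Fintype 𝒳] (hn : 2 ≤ Fintype.card 𝒳)
    (P Q : 𝒳 → ℝ) (hP : ∀ x, 0 ≤ P x) (hQ : ∀ x, 0 ≤ Q x) :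
    huffLen Q - ((Fintype.card 𝒳 : ℝ) - 1) * ∑ x : 𝒳, |P x - Q x| ≤ huffLen P := by
  refine le_csInf ?_ ?_
  · refine ⟨_, fun _ => Fintype.card 𝒳, fun _ => (by omega : 1 ≤ Fintype.card 𝒳), ?_, rfl⟩
    rw [kraft_iff _ (Fintype.card 𝒳) (fun _ => le_rfl)]
    simpa using Nat.lt_two_pow_self.le
  · rintro r ⟨l, h1, hK, rfl⟩
    obtain ⟨l', a, b, c, d⟩ := exists_short hn _ l rfl h1 hK
    have hq : huffLen Q ≤ ∑ x, Q x * (l' x : ℝ) := by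
      refine csInf_le ⟨0, ?_⟩ ⟨l', a, b, rfl⟩
      rintro r ⟨k, _, _, rfl⟩
      exact Finset.sum_nonneg fun x _ => mul_nonneg (hQ x) (Nat.cast_nonneg _)
    have hs : ∑ x, Q x * (l' x : ℝ) ≤
        ∑ x, (P x * (l x : ℝ) + ((Fintype.card 𝒳 : ℝ) - 1) * |P x - Q x|) := by
      refine Finset.sum_le_sum fun x _ => ?_
      have c' : (l' x : ℝ) ≤ l x := by exact_mod_cast c x
      have d' : (l' x : ℝ) ≤ (Fintype.card 𝒳 : ℝ) - 1 := by
        have : l' x + 1 ≤ Fintype.card 𝒳 := by have := d x; omega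
        have : (l' x : ℝ) + 1 ≤ (Fintype.card 𝒳 : ℝ) := by exact_mod_cast this
        linarith
      have p1 := mul_le_mul_of_nonneg_left c' (hP x)
      have p2 := mul_le_mul_of_nonneg_right d' (abs_nonneg (P x - Q x))
      have p3 := mul_le_mul_of_nonneg_left (neg_abs_le (P x - Q x))
        (Nat.cast_nonneg (α := ℝ) (l' x))
      linarith
    rw [Finset.sum_add_distrib, ← Finset.mul_sum] at hs
    linarith



/-- **The Huffman length is continuous in variational distance:**
for any two probability distributions `P` and `Q` on a finite alphabet `𝒳`,
`|L(P) − L(Q)| ≤ (|𝒳| − 1) · ‖P − Q‖₁`; in particular, if `‖P − Q‖₁ ≤ ε` then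
`L(P) ≥ L(Q) − ε (|𝒳| − 1)`. -/
theorem abs_huffLen_sub_le {𝒳 : Type*} [Fintype 𝒳] [Nonempty 𝒳]
    (P Q : 𝒳 → ℝ) (hP : ∀ x, 0 ≤ P x) (hP1 : ∑ x : 𝒳, P x = 1)
    (hQ : ∀ x, 0 ≤ Q x) (hQ1 : ∑ x : 𝒳, Q x = 1) :
    |huffLen P - huffLen Q| ≤ ((Fintype.card 𝒳 : ℝ) - 1) * ∑ x : 𝒳, |P x - Q x| ∧
      ∀ ε : ℝ, (∑ x : 𝒳, |P x - Q x|) ≤ ε →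
        huffLen Q - ε * ((Fintype.card 𝒳 : ℝ) - 1) ≤ huffLen P := by
  have hpos : 0 < Fintype.card 𝒳 := Fintype.card_pos
  have hc : (0 : ℝ) ≤ (Fintype.card 𝒳 : ℝ) - 1 := by
    have : (1 : ℝ) ≤ (Fintype.card 𝒳 : ℝ) := by exact_mod_cast hpos
    linarith
  have key : |huffLen P - huffLen Q| ≤ ((Fintype.card 𝒳 : ℝ) - 1) * ∑ x : 𝒳, |P x - Q x| := by
    rcases Nat.lt_or_ge (Fintype.card 𝒳) 2 with h | h
    · obtain ⟨z, hz⟩ := Fintype.card_eq_one_iff.mp (show Fintype.card 𝒳 = 1 by omega)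
      have hu : (Finset.univ : Finset 𝒳) = {z} := by
        ext x; simp [hz x]
      rw [hu, Finset.sum_singleton] at hP1 hQ1
      have : P = Q := by
        funext x; rw [hz x, hP1, hQ1]
      subst this
      simp
    · have h1 := huff_one_side h P Q hP hQ
      have h2 := huff_one_side h Q P hQ hP
      simp only [abs_sub_comm (Q _) (P _)] at h2
      rw [abs_le]
      constructor <;> linarith
  refine ⟨key, fun ε hε => ?_⟩
  have h1 := mul_le_mul_of_nonneg_left hε hc
  have h2 := (abs_le.mp key).1
  linarith
end
end

section
/- Let (X_1, Y_1, W_1), …, (X_n, Y_n, W_n) be i.i.d. triples on finite alphabets distributed according to P(x)P(y|x)P(w|y), let K be independent of (X^n, Y^n, W^n), and let Z = ψ(K, X^n) for a deterministic function ψ. Then H(X^n | K, W^n, Z) ≤ n·I(X;Y|W) + H(X^n | K, Y^n, Z). -/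
open scoped BigOperators Classical

noncomputable section

/-- Shannon entropy (in bits) of the random variable `F` on the finite probability space
`(Ω, p)`. -/
def ent {Ω : Type*} [Fintype Ω] (p : Ω → ℝ) {β : Type*} (F : Ω → β) : ℝ :=
  ∑ ω : Ω, -(p ω * Real.logb 2 (pr p (fun ω' => F ω' = F ω)))

/-- Conditional Shannon entropy (in bits) `H(F|G) = H(F,G) − H(G)`. -/
def condEnt {Ω : Type*} [Fintype Ω] (p : Ω → ℝ) {β γ : Type*} (F : Ω → β) (G : Ω → γ) : ℝ :=
  ent p (fun ω => (F ω, G ω)) - ent p G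

/-- Conditional mutual information (in bits) `I(F;G|H) = H(F|H) − H(F|G,H)`. -/
def condMI {Ω : Type*} [Fintype Ω] (p : Ω → ℝ) {β γ δ : Type*}
    (F : Ω → β) (G : Ω → γ) (H : Ω → δ) : ℝ :=
  condEnt p F H - condEnt p F (fun ω => (G ω, H ω))

lemma pr_congr {Ω : Type*} [Fintype Ω] (p : Ω → ℝ) {E E' : Ω → Prop} (h : ∀ ω, E ω ↔ E' ω) :
    pr p E = pr p E' := by
  have : E = E' := funext fun ω => propext (h ω)
  rw [this]

lemma ent_congr {Ω : Type*} [Fintype Ω] (p : Ω → ℝ) {β γ : Type*} (F : Ω → β) (G : Ω → γ)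
    (h : ∀ ω ω', F ω' = F ω ↔ G ω' = G ω) : ent p F = ent p G := by
  unfold ent
  refine Finset.sum_congr rfl fun ω _ => ?_
  rw [pr_congr p (h ω)]

lemma pr_nonneg {Ω : Type*} [Fintype Ω] (p : Ω → ℝ) (hp : ∀ ω, 0 ≤ p ω) (E : Ω → Prop) :
    0 ≤ pr p E := by
  unfold pr
  refine Finset.sum_nonneg fun ω _ => ?_
  split_ifs
  · exact hp ω
  · exact le_rfl

lemma le_pr {Ω : Type*} [Fintype Ω] (p : Ω → ℝ) (hp : ∀ ω, 0 ≤ p ω) (E : Ω → Prop) (ω : Ω)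
    (h : E ω) : p ω ≤ pr p E := by
  unfold pr
  have := Finset.single_le_sum (f := fun ω => if E ω then p ω else 0) (s := Finset.univ)
    (fun ω _ => by split_ifs; exacts [hp ω, le_rfl]) (Finset.mem_univ ω)
  simpa [h] using this

lemma markov_ent {Ω A 𝒲 𝒴 β : Type*} [Fintype Ω] [Fintype A] [Fintype 𝒲]
    (p : Ω → ℝ) (hp0 : ∀ ω, 0 ≤ p ω) (e : Ω ≃ A × 𝒲) (r : A → ℝ) (g : A → 𝒴) (v : 𝒴 → 𝒲 → ℝ)
    (hv : ∀ y, ∑ w, v y w = 1)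
    (hp : ∀ ω, p ω = r (e ω).1 * v (g (e ω).1) (e ω).2)
    (F : A → β) (hF : ∀ a a', F a = F a' → g a = g a') :
    ent p (fun ω => (F (e ω).1, (e ω).2)) =
      ent p (fun ω => F (e ω).1) + ∑ ω, -(p ω * Real.logb 2 (v (g (e ω).1) (e ω).2)) := by
  unfold ent
  rw [← Finset.sum_add_distrib]
  refine Finset.sum_congr rfl fun ω _ => ?_
  have h1 : pr p (fun ω' => F (e ω').1 = F (e ω).1) = pr r (fun a => F a = F (e ω).1) := by
    unfold pr
    rw [Fintype.sum_equiv e _ (fun b : A × 𝒲 => if F b.1 = F (e ω).1 then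
      r b.1 * v (g b.1) b.2 else 0) (fun ω' => by rw [hp]), Fintype.sum_prod_type]
    refine Finset.sum_congr rfl fun a _ => ?_
    by_cases h : F a = F (e ω).1
    · simp only [h, if_true]
      rw [← Finset.mul_sum, hv, mul_one]
    · simp [h]
  have h2 : pr p (fun ω' => (F (e ω').1, (e ω').2) = (F (e ω).1, (e ω).2)) =
      pr r (fun a => F a = F (e ω).1) * v (g (e ω).1) (e ω).2 := by
    unfold pr
    rw [Fintype.sum_equiv e _ (fun b : A × 𝒲 => if (b.1 |> F, b.2) = (F (e ω).1, (e ω).2) then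
      r b.1 * v (g b.1) b.2 else 0) (fun ω' => by rw [hp]; congr), Fintype.sum_prod_type,
      Finset.sum_mul]
    refine Finset.sum_congr rfl fun a _ => ?_
    by_cases h : F a = F (e ω).1
    · simp [h, hF _ _ h]
    · simp [h]
  rw [h1, h2]
  by_cases h0 : p ω = 0
  · simp [h0]
  have hpos : 0 < p ω := lt_of_le_of_ne (hp0 ω) (Ne.symm h0)
  have hv0 : v (g (e ω).1) (e ω).2 ≠ 0 := by
    intro h; apply h0; rw [hp, h, mul_zero]
  have hr : pr r (fun a => F a = F (e ω).1) ≠ 0 := by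
    rw [← h1]
    exact (lt_of_lt_of_le hpos (le_pr p hp0 (fun ω' => F (e ω').1 = F (e ω).1) ω rfl)).ne'
  rw [Real.logb_mul hr hv0]
  ring

lemma sum_pi_prod {A : Type*} [Fintype A] (n : ℕ) (f : Fin n → A → ℝ) :
    ∑ ω : Fin n → A, ∏ i, f i (ω i) = ∏ i, ∑ a, f i a := by
  rw [Finset.prod_univ_sum, Fintype.piFinset_univ]

lemma sum_pi_single {A : Type*} [Fintype A] (n : ℕ) (q : A → ℝ) (hq : ∑ a, q a = 1)
    (f : A → ℝ) (i : Fin n) :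
    ∑ ω : Fin n → A, (∏ j, q (ω j)) * f (ω i) = ∑ a, q a * f a := by
  have h := sum_pi_prod n (fun j a => q a * if j = i then f a else 1)
  have h1 : ∀ ω : Fin n → A, ∏ j, (q (ω j) * if j = i then f (ω j) else 1)
      = (∏ j, q (ω j)) * f (ω i) := by
    intro ω
    rw [Finset.prod_mul_distrib]
    simp
  simp only [h1] at h
  rw [h, Finset.prod_eq_single i]
  · simp
  · intro j _ hj
    simp [hj, hq]
  · simp

lemma ent_prod {A B 𝒦 : Type*} [Fintype A] [Fintype 𝒦] (n : ℕ) (q : A → ℝ)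
    (hq0 : ∀ a, 0 ≤ q a) (hq : ∑ a, q a = 1) (pk : 𝒦 → ℝ) (hk0 : ∀ k, 0 ≤ pk k)
    (hk : ∑ k, pk k = 1) (F : A → B) :
    ent (fun ω : (Fin n → A) × 𝒦 => (∏ i, q (ω.1 i)) * pk ω.2)
      (fun ω => ((fun i => F (ω.1 i)), ω.2)) =
    n * ent q F + ∑ k, -(pk k * Real.logb 2 (pk k)) := by
  have hpr : ∀ ω : (Fin n → A) × 𝒦,
      pr (fun ω : (Fin n → A) × 𝒦 => (∏ i, q (ω.1 i)) * pk ω.2)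
        (fun ω' => ((fun i => F (ω'.1 i)), ω'.2) = ((fun i => F (ω.1 i)), ω.2)) =
      (∏ i, pr q (fun a => F a = F (ω.1 i))) * pk ω.2 := by
    intro ω
    unfold pr
    rw [← sum_pi_prod n (fun i a => if F a = F (ω.1 i) then q a else 0), Fintype.sum_prod_type,
      Finset.sum_mul]
    refine Finset.sum_congr rfl fun a _ => ?_
    rw [Finset.sum_eq_single ω.2]
    · by_cases h : ∀ i, F (a i) = F (ω.1 i)
      · simp [h]
      · have h' : ¬ ((fun i => F (a i)) = fun i => F (ω.1 i)) := fun hh => h (congrFun hh)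
        push Not at h
        obtain ⟨i, hi⟩ := h
        rw [Finset.prod_eq_zero (Finset.mem_univ i) (by simp [hi])]
        simp [h']
    · intro k _ hk
      simp [hk]
    · simp
  have hterm : ∀ ω : (Fin n → A) × 𝒦,
      -((∏ i, q (ω.1 i)) * pk ω.2 * Real.logb 2 (pr (fun ω : (Fin n → A) × 𝒦 => (∏ i, q (ω.1 i)) * pk ω.2)
        (fun ω' => ((fun i => F (ω'.1 i)), ω'.2) = ((fun i => F (ω.1 i)), ω.2)))) =
      pk ω.2 * (∑ i, (∏ j, q (ω.1 j)) * (- Real.logb 2 (pr q (fun a => F a = F (ω.1 i)))))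
        + (∏ j, q (ω.1 j)) * -(pk ω.2 * Real.logb 2 (pk ω.2)) := by
    intro ω
    rw [hpr]
    by_cases h1 : ∏ i, q (ω.1 i) = 0
    · simp [h1]
    by_cases h2 : pk ω.2 = 0
    · simp [h2]
    have h3 : ∀ i, pr q (fun a => F a = F (ω.1 i)) ≠ 0 := by
      intro i
      have : q (ω.1 i) ≠ 0 := (Finset.prod_ne_zero_iff.mp h1) i (Finset.mem_univ i)
      exact (lt_of_lt_of_le (lt_of_le_of_ne (hq0 _) this.symm)
        (le_pr q hq0 (fun a => F a = F (ω.1 i)) _ rfl)).ne'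
    rw [Real.logb_mul (Finset.prod_ne_zero_iff.mpr fun i _ => h3 i) h2,
      Real.logb_prod _ _ (fun i _ => h3 i), ← Finset.mul_sum, Finset.sum_neg_distrib]
    ring
  rw [ent, Finset.sum_congr rfl (fun ω _ => hterm ω), Finset.sum_add_distrib]
  congr 1
  · rw [Fintype.sum_prod_type_right]
    rw [Finset.sum_congr rfl (fun k _ => (Finset.mul_sum _ _ _).symm)]
    dsimp only
    rw [← Finset.sum_mul, hk, one_mul, Finset.sum_comm]
    rw [Finset.sum_congr rfl (fun i _ => sum_pi_single n q hq
      (fun b => - Real.logb 2 (pr q (fun a => F a = F b))) i)]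
    simp [ent]
  · rw [Fintype.sum_prod_type]
    simp only [← Finset.mul_sum]
    rw [← Finset.sum_mul, sum_pi_prod n (fun _ a => q a)]
    simp [hq]

lemma ent_submod {Ω β γ δ : Type*} [Fintype Ω] (p : Ω → ℝ) (hp0 : ∀ ω, 0 ≤ p ω)
    (F : Ω → β) (G : Ω → γ) (C : Ω → δ) :
    ent p (fun ω => (F ω, G ω, C ω)) + ent p C ≤
      ent p (fun ω => (F ω, C ω)) + ent p (fun ω => (G ω, C ω)) := by
  set a := fun ω => pr p (fun ω' => (F ω', G ω', C ω') = (F ω, G ω, C ω)) with ha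
  set b := fun ω => pr p (fun ω' => C ω' = C ω) with hb
  set c := fun ω => pr p (fun ω' => (F ω', C ω') = (F ω, C ω)) with hc
  set d := fun ω => pr p (fun ω' => (G ω', C ω') = (G ω, C ω)) with hd
  have a0 : ∀ ω, 0 ≤ a ω := fun ω => pr_nonneg p hp0 _
  have b0 : ∀ ω, 0 ≤ b ω := fun ω => pr_nonneg p hp0 _
  -- the key bound
  have inner : ∀ ω1 ω2, ∑ ω, p ω / (a ω * b ω) *
      ((if (F ω1, C ω1) = (F ω, C ω) then 1 else 0) *
        (if (G ω2, C ω2) = (G ω, C ω) then 1 else 0)) ≤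
      if C ω2 = C ω1 then (b ω1)⁻¹ else 0 := by
    intro ω1 ω2
    by_cases hne : ∃ ω0, (F ω1, C ω1) = (F ω0, C ω0) ∧ (G ω2, C ω2) = (G ω0, C ω0)
    · obtain ⟨ω0, h1, h2⟩ := hne
      simp only [Prod.mk.injEq] at h1 h2
      have hC : C ω2 = C ω1 := h2.2.trans h1.2.symm
      rw [if_pos hC]
      have : ∀ ω, p ω / (a ω * b ω) *
          ((if (F ω1, C ω1) = (F ω, C ω) then 1 else 0) *
          (if (G ω2, C ω2) = (G ω, C ω) then 1 else 0)) =
          (if (F ω, G ω, C ω) = (F ω0, G ω0, C ω0) then p ω else 0) * (a ω0 * b ω1)⁻¹ := by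
        intro ω
        by_cases h : (F ω, G ω, C ω) = (F ω0, G ω0, C ω0)
        · have haa : a ω = a ω0 := by simp only [ha, h]
          simp only [Prod.mk.injEq] at h
          have hbb : b ω = b ω1 := by simp only [hb, h.2.2, h1.2]
          rw [haa, hbb]
          simp [h, h1, h2, div_eq_mul_inv]
        · have : ¬ ((F ω1, C ω1) = (F ω, C ω) ∧ (G ω2, C ω2) = (G ω, C ω)) := by
            rintro ⟨h3, h4⟩
            simp only [Prod.mk.injEq] at h3 h4
            apply h
            simp [← h3.1, ← h4.1, ← h3.2, h1, h2]
          rw [if_neg h]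
          by_cases h3 : (F ω1, C ω1) = (F ω, C ω)
          · have h4 : ¬ (G ω2, C ω2) = (G ω, C ω) := fun h4 => this ⟨h3, h4⟩
            rw [if_neg h4]; simp
          · rw [if_neg h3]; simp
      rw [Finset.sum_congr rfl (fun ω _ => this ω), ← Finset.sum_mul]
      have hs : (∑ ω, if (F ω, G ω, C ω) = (F ω0, G ω0, C ω0) then p ω else 0) = a ω0 := by
        simp only [ha, pr]
        refine Finset.sum_congr rfl fun _ _ => ?_
        congr
      rw [hs]
      rw [mul_inv, ← mul_assoc]
      exact mul_le_of_le_one_left (inv_nonneg.mpr (b0 _)) mul_inv_le_one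
    · push Not at hne
      rw [Finset.sum_eq_zero]
      · split_ifs
        · exact inv_nonneg.mpr (b0 _)
        · exact le_rfl
      · intro ω _
        by_cases h3 : (F ω1, C ω1) = (F ω, C ω)
        · rw [if_neg (hne ω h3)]; simp
        · rw [if_neg h3]; simp
  have key : ∑ ω, p ω / (a ω * b ω) * (c ω * d ω) ≤ ∑ ω, p ω := by
    have e1 : ∑ ω, p ω / (a ω * b ω) * (c ω * d ω) = ∑ ω1, ∑ ω2, p ω1 * p ω2 *
        ∑ ω, p ω / (a ω * b ω) *
      ((if (F ω1, C ω1) = (F ω, C ω) then 1 else 0) *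
        (if (G ω2, C ω2) = (G ω, C ω) then 1 else 0)) := by
      have : ∀ ω, p ω / (a ω * b ω) * (c ω * d ω) = ∑ ω1, ∑ ω2, p ω1 * p ω2 *
          (p ω / (a ω * b ω) * ((if (F ω1, C ω1) = (F ω, C ω) then 1 else 0) *
        (if (G ω2, C ω2) = (G ω, C ω) then 1 else 0))) := by
        intro ω
        simp only [hc, hd, pr]
        rw [Finset.sum_mul_sum, Finset.mul_sum]
        refine Finset.sum_congr rfl fun ω1 _ => ?_
        rw [Finset.mul_sum]
        refine Finset.sum_congr rfl fun ω2 _ => ?_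
        split_ifs <;> ring
      rw [Finset.sum_congr rfl (fun ω _ => this ω), Finset.sum_comm]
      refine Finset.sum_congr rfl fun ω1 _ => ?_
      rw [Finset.sum_comm]
      refine Finset.sum_congr rfl fun ω2 _ => ?_
      rw [Finset.mul_sum]
    rw [e1]
    refine Finset.sum_le_sum fun ω1 _ => ?_
    calc _ ≤ ∑ ω2, p ω1 * p ω2 * (if C ω2 = C ω1 then (b ω1)⁻¹ else 0) :=
          Finset.sum_le_sum fun ω2 _ =>
            mul_le_mul_of_nonneg_left (inner ω1 ω2) (mul_nonneg (hp0 _) (hp0 _))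
      _ = p ω1 * (b ω1 * (b ω1)⁻¹) := by
          conv_rhs => rw [hb]
          simp only [pr]
          rw [Finset.sum_mul, Finset.mul_sum]
          refine Finset.sum_congr rfl fun ω2 _ => ?_
          split_ifs
          · simp only [hb, pr]; ring
          · ring
      _ ≤ p ω1 := mul_le_of_le_one_right (hp0 _) mul_inv_le_one
  have point : ∀ ω, -(p ω * Real.logb 2 (a ω)) + -(p ω * Real.logb 2 (b ω))
      - (-(p ω * Real.logb 2 (c ω)) + -(p ω * Real.logb 2 (d ω))) ≤
      (p ω / (a ω * b ω) * (c ω * d ω) - p ω) / Real.log 2 := by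
    intro ω
    by_cases h0 : p ω = 0
    · simp [h0]
    have hpos : 0 < p ω := lt_of_le_of_ne (hp0 ω) (Ne.symm h0)
    have ap : 0 < a ω := lt_of_lt_of_le hpos (le_pr p hp0 _ ω rfl)
    have bp : 0 < b ω := lt_of_lt_of_le hpos (le_pr p hp0 _ ω rfl)
    have cp : 0 < c ω := lt_of_lt_of_le hpos (le_pr p hp0 _ ω rfl)
    have dp : 0 < d ω := lt_of_lt_of_le hpos (le_pr p hp0 _ ω rfl)
    have hl := Real.log_le_sub_one_of_pos (x := (c ω * d ω) / (a ω * b ω)) (by positivity)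
    rw [Real.log_div (by positivity) (by positivity), Real.log_mul cp.ne' dp.ne',
      Real.log_mul ap.ne' bp.ne'] at hl
    have hl2 : 0 < Real.log 2 := Real.log_pos (by norm_num)
    simp only [Real.logb]
    rw [le_div_iff₀ hl2]
    have := mul_le_mul_of_nonneg_left hl hpos.le
    calc _ = p ω * (Real.log (c ω) + Real.log (d ω) - (Real.log (a ω) + Real.log (b ω))) := by
          field_simp
          ring
      _ ≤ _ := this
      _ = _ := by ring
  have tot := Finset.sum_le_sum (s := Finset.univ) fun ω _ => point ω
  rw [← Finset.sum_div, Finset.sum_sub_distrib, Finset.sum_sub_distrib, Finset.sum_add_distrib,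
    Finset.sum_add_distrib] at tot
  have hneg : (∑ ω, p ω / (a ω * b ω) * (c ω * d ω) - ∑ ω, p ω) / Real.log 2 ≤ 0 :=
    div_nonpos_of_nonpos_of_nonneg (by linarith) (Real.log_pos (by norm_num)).le
  have := tot.trans hneg
  unfold ent
  linarith

/-- Splitting off the third component of every letter. -/
def splitEquiv (n : ℕ) (𝒳 𝒴 𝒲 𝒦 : Type*) : ((Fin n → 𝒳 × 𝒴 × 𝒲) × 𝒦) ≃
    ((Fin n → 𝒳) × (Fin n → 𝒴) × 𝒦) × (Fin n → 𝒲) where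
  toFun ω := ((fun i => (ω.1 i).1, fun i => (ω.1 i).2.1, ω.2), fun i => (ω.1 i).2.2)
  invFun b := (fun i => (b.1.1 i, b.1.2.1 i, b.2 i), b.1.2.2)
  left_inv _ := rfl
  right_inv _ := rfl

/-- **Degraded side-information bound.** Let `(X_t, Y_t, W_t)` be i.i.d. triples
distributed according to `P(x)·P(y|x)·P(w|y)` on finite alphabets (degraded structure
`X ↔ Y ↔ W`, realized canonically on the product space `(Fin n → 𝒳 × 𝒴 × 𝒲) × 𝒦`),
let `K ~ pk` be independent of the source, and let `Z = ψ(K, X^n)`. Then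
`H(X^n | K, W^n, Z) ≤ n·I(X;Y|W) + H(X^n | K, Y^n, Z)`. -/
theorem condEnt_le_nCondMI_add_condEnt
    {𝒳 𝒴 𝒲 𝒦 𝒵 : Type*} [Fintype 𝒳] [Fintype 𝒴] [Fintype 𝒲] [Fintype 𝒦]
    (P : 𝒳 → ℝ) (hP : ∀ x, 0 ≤ P x) (hP1 : ∑ x : 𝒳, P x = 1)
    (Py : 𝒳 → 𝒴 → ℝ) (hPy : ∀ x y, 0 ≤ Py x y) (hPy1 : ∀ x, ∑ y : 𝒴, Py x y = 1)
    (Pw : 𝒴 → 𝒲 → ℝ) (hPw : ∀ y w, 0 ≤ Pw y w) (hPw1 : ∀ y, ∑ w : 𝒲, Pw y w = 1)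
    (pk : 𝒦 → ℝ) (hpk : ∀ k, 0 ≤ pk k) (hpk1 : ∑ k : 𝒦, pk k = 1)
    (n : ℕ) (ψ : 𝒦 → (Fin n → 𝒳) → 𝒵)
    (p1 : 𝒳 × 𝒴 × 𝒲 → ℝ)
    (hp1 : p1 = fun a => P a.1 * Py a.1 a.2.1 * Pw a.2.1 a.2.2)
    (p : ((Fin n → 𝒳 × 𝒴 × 𝒲) × 𝒦) → ℝ)
    (hp : p = fun ω => (∏ i, p1 (ω.1 i)) * pk ω.2) :
    condEnt p (fun ω => fun i => (ω.1 i).1)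
        (fun ω => (ω.2, (fun i => (ω.1 i).2.2), ψ ω.2 (fun i => (ω.1 i).1)))
      ≤ (n : ℝ) * condMI p1 (fun a => a.1) (fun a => a.2.1) (fun a => a.2.2)
        + condEnt p (fun ω => fun i => (ω.1 i).1)
            (fun ω => (ω.2, (fun i => (ω.1 i).2.1), ψ ω.2 (fun i => (ω.1 i).1))) := by
  have hp10 : ∀ a, 0 ≤ p1 a := by
    intro a; rw [hp1]
    exact mul_nonneg (mul_nonneg (hP _) (hPy _ _)) (hPw _ _)
  have hp1s : ∑ a, p1 a = 1 := by
    rw [hp1]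
    simp only [Fintype.sum_prod_type]
    simp only [← Finset.mul_sum, hPw1, mul_one, hPy1, hP1]
  have hp0 : ∀ ω, 0 ≤ p ω := by
    intro ω; rw [hp]
    exact mul_nonneg (Finset.prod_nonneg fun i _ => hp10 _) (hpk _)
  -- single-letter Markov identities
  have m1 := markov_ent p1 hp10 (Equiv.prodAssoc 𝒳 𝒴 𝒲).symm (fun a => P a.1 * Py a.1 a.2)
    (fun a => a.2) Pw hPw1 (fun ω => by rw [hp1]; rfl) (fun a => a) (fun a a' h => by rw [h])
  have m2 := markov_ent p1 hp10 (Equiv.prodAssoc 𝒳 𝒴 𝒲).symm (fun a => P a.1 * Py a.1 a.2)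
    (fun a => a.2) Pw hPw1 (fun ω => by rw [hp1]; rfl) (fun a => a.2) (fun a a' h => h)
  -- block Markov identities
  have hvn : ∀ y : Fin n → 𝒴, ∑ w : Fin n → 𝒲, ∏ i, Pw (y i) (w i) = 1 := by
    intro y
    rw [sum_pi_prod n (fun i w => Pw (y i) w)]
    simp [hPw1]
  have hfac : ∀ ω, p ω = (fun b : (Fin n → 𝒳) × (Fin n → 𝒴) × 𝒦 =>
      (∏ i, P (b.1 i) * Py (b.1 i) (b.2.1 i)) * pk b.2.2) (splitEquiv n 𝒳 𝒴 𝒲 𝒦 ω).1 *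
      (fun (y : Fin n → 𝒴) (w : Fin n → 𝒲) => ∏ i, Pw (y i) (w i))
        ((fun b : (Fin n → 𝒳) × (Fin n → 𝒴) × 𝒦 => b.2.1) (splitEquiv n 𝒳 𝒴 𝒲 𝒦 ω).1)
        (splitEquiv n 𝒳 𝒴 𝒲 𝒦 ω).2 := by
    intro ω
    rw [hp, hp1]
    simp only [splitEquiv, Equiv.coe_fn_mk]
    rw [Finset.prod_mul_distrib]
    ring
  have m3 := markov_ent p hp0 (splitEquiv n 𝒳 𝒴 𝒲 𝒦)
    (fun b : (Fin n → 𝒳) × (Fin n → 𝒴) × 𝒦 => (∏ i, P (b.1 i) * Py (b.1 i) (b.2.1 i)) * pk b.2.2)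
    (fun b => b.2.1) (fun y w => ∏ i, Pw (y i) (w i)) hvn hfac
    (fun b => (ψ b.2.2 b.1, b.2.1, b.2.2)) (fun a a' h => by
      simp only [Prod.mk.injEq] at h; exact h.2.1)
  have m4 := markov_ent p hp0 (splitEquiv n 𝒳 𝒴 𝒲 𝒦)
    (fun b : (Fin n → 𝒳) × (Fin n → 𝒴) × 𝒦 => (∏ i, P (b.1 i) * Py (b.1 i) (b.2.1 i)) * pk b.2.2)
    (fun b => b.2.1) (fun y w => ∏ i, Pw (y i) (w i)) hvn hfac
    (fun b => (b.2.1, b.2.2)) (fun a a' h => by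
      simp only [Prod.mk.injEq] at h; exact h.1)
  simp only [splitEquiv, Equiv.coe_fn_mk] at m3 m4
  simp only [Equiv.prodAssoc_symm_apply] at m1 m2
  have sub := ent_submod p hp0 (fun ω => ψ ω.2 (fun i => (ω.1 i).1)) (fun ω i => (ω.1 i).2.1)
    (fun ω => ((fun i => (ω.1 i).2.2), ω.2))
  have t1 := ent_prod n p1 hp10 hp1s pk hpk hpk1 (fun a => (a.1, a.2.2))
  have t2 := ent_prod n p1 hp10 hp1s pk hpk hpk1 (fun a => (a.1, a.2.1))
  have t3 := ent_prod n p1 hp10 hp1s pk hpk hpk1 (fun a => a.2.1)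
  have t4 := ent_prod n p1 hp10 hp1s pk hpk hpk1 (fun a => a.2.2)
  rw [← hp] at t1 t2 t3 t4
  unfold condMI condEnt
  -- identify the joint entropies
  have c1 : ent p (fun ω => ((fun i => (ω.1 i).1),
      (ω.2, (fun i => (ω.1 i).2.2), ψ ω.2 (fun i => (ω.1 i).1)))) =
      ent p (fun ω => ((fun i => ((ω.1 i).1, (ω.1 i).2.2)), ω.2)) := by
    apply ent_congr
    intro ω ω'
    simp only [Prod.mk.injEq, funext_iff]
    constructor
    · rintro ⟨h1, h2, h3, -⟩
      exact ⟨fun i => ⟨h1 i, h3 i⟩, h2⟩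
    · rintro ⟨h1, h2⟩
      refine ⟨fun i => (h1 i).1, h2, fun i => (h1 i).2, ?_⟩
      rw [h2]; congr 1; funext i; exact (h1 i).1
  have c2 : ent p (fun ω => ((fun i => (ω.1 i).1),
      (ω.2, (fun i => (ω.1 i).2.1), ψ ω.2 (fun i => (ω.1 i).1)))) =
      ent p (fun ω => ((fun i => ((ω.1 i).1, (ω.1 i).2.1)), ω.2)) := by
    apply ent_congr
    intro ω ω'
    simp only [Prod.mk.injEq, funext_iff]
    constructor
    · rintro ⟨h1, h2, h3, -⟩
      exact ⟨fun i => ⟨h1 i, h3 i⟩, h2⟩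
    · rintro ⟨h1, h2⟩
      refine ⟨fun i => (h1 i).1, h2, fun i => (h1 i).2, ?_⟩
      rw [h2]; congr 1; funext i; exact (h1 i).1
  have c3 : ent p (fun ω => (ω.2, (fun i => (ω.1 i).2.2), ψ ω.2 (fun i => (ω.1 i).1))) =
      ent p (fun ω => (ψ ω.2 (fun i => (ω.1 i).1), (fun i => (ω.1 i).2.2), ω.2)) := by
    apply ent_congr; intro ω ω'; simp only [Prod.mk.injEq]; tauto
  have c4 : ent p (fun ω => (ω.2, (fun i => (ω.1 i).2.1), ψ ω.2 (fun i => (ω.1 i).1))) =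
      ent p (fun ω => (ψ ω.2 (fun i => (ω.1 i).1), (fun i => (ω.1 i).2.1), ω.2)) := by
    apply ent_congr; intro ω ω'; simp only [Prod.mk.injEq]; tauto
  have c5 : ent p (fun ω => (ψ ω.2 (fun i => (ω.1 i).1), (fun i => (ω.1 i).2.1),
        ((fun i => (ω.1 i).2.2), ω.2))) =
      ent p (fun ω => ((ψ ω.2 (fun i => (ω.1 i).1), (fun i => (ω.1 i).2.1), ω.2),
        (fun i => (ω.1 i).2.2))) := by
    apply ent_congr; intro ω ω'; simp only [Prod.mk.injEq]; tauto
  have c6 : ent p (fun ω => ((fun i => (ω.1 i).2.1), ((fun i => (ω.1 i).2.2), ω.2))) =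
      ent p (fun ω => (((fun i => (ω.1 i).2.1), ω.2), (fun i => (ω.1 i).2.2))) := by
    apply ent_congr; intro ω ω'; simp only [Prod.mk.injEq]; tauto
  have c7 : ent p1 (fun a => (a.1, (a.2.1, a.2.2))) = ent p1 (fun a => ((a.1, a.2.1), a.2.2)) := by
    apply ent_congr; intro ω ω'; simp only [Prod.mk.injEq]; tauto
  rw [c1, c2, c3, c4, c7, t1, t2, m1, m2]
  rw [c5, c6, m3, m4, t3, t4] at sub
  linarith
end
end
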